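/- arXiv:2109.10705 — 2 statements merged into one kernel-verified Lean document; each statement's English description precedes it below -/
import Mathlib

section
/- There exists a set of 25 points in the plane in general position that contains no 6-crossing family. -/
/-- A finite set of points in the plane is in *general position* if no three of
its points are collinear. -/
def GenPos (S : Finset (ℝ × ℝ)) : Prop :=
  ∀ p ∈ S, ∀ q ∈ S, ∀ r ∈ S, p ≠ q → p ≠ r → q ≠ r →
    ¬Collinear ℝ ({p, q, r} : Set (ℝ × ℝ))

/-- Two closed segments `pq` and `rs` *cross* if they intersect in exactly one
point, which lies in the interior of both segments. -/
def Crosses (p q r s : ℝ × ℝ) : Prop :=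
  ∃ x : ℝ × ℝ, x ∈ openSegment ℝ p q ∧ x ∈ openSegment ℝ r s ∧
    segment ℝ p q ∩ segment ℝ r s = {x}

/-- `F` is a *crossing family* in `S`: a finite set of segments (given by their
pairs of distinct endpoints, which belong to `S`) that pairwise cross. -/
def IsCrossingFamily (S : Finset (ℝ × ℝ)) (F : Finset ((ℝ × ℝ) × (ℝ × ℝ))) : Prop :=
  (∀ e ∈ F, e.1 ∈ S ∧ e.2 ∈ S ∧ e.1 ≠ e.2) ∧
  (∀ e ∈ F, ∀ f ∈ F, e ≠ f → Crosses e.1 e.2 f.1 f.2)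

/-- `S` contains a `k`-crossing family. -/
def HasCrossingFamily (S : Finset (ℝ × ℝ)) (k : ℕ) : Prop :=
  ∃ F : Finset ((ℝ × ℝ) × (ℝ × ℝ)), IsCrossingFamily S F ∧ F.card = k

/-- `cf S`: the maximum size of a crossing family in `S`. -/
noncomputable def cf (S : Finset (ℝ × ℝ)) : ℕ :=
  sSup {k : ℕ | HasCrossingFamily S k}

/-- `cfNat n`: the minimum of `cf S` over all sets `S` of `n` points in
general position. -/
noncomputable def cfNat (n : ℕ) : ℕ :=
  sInf {m : ℕ | ∃ S : Finset (ℝ × ℝ), S.card = n ∧ GenPos S ∧ cf S = m}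

namespace CrossingFamily

/-- Twice the signed area of the triangle `pqr`. -/
def det (p q r : ℝ × ℝ) : ℝ :=
  (p.1 * q.2 + q.1 * r.2 + r.1 * p.2) - (p.1 * r.2 + q.1 * p.2 + r.1 * q.2)

lemma det_eq_zero_of_collinear {p q r : ℝ × ℝ} (h : Collinear ℝ {p, q, r}) :
    det p q r = 0 := by
  obtain ⟨v, hv⟩ := (collinear_iff_of_mem (p₀ := p) (by simp)).1 h
  obtain ⟨a, rfl⟩ := hv q (by simp)
  obtain ⟨b, rfl⟩ := hv r (by simp)
  simp only [det, vadd_eq_add, Prod.fst_add, Prod.snd_add, Prod.smul_fst, Prod.smul_snd,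
    smul_eq_mul]
  ring

/-- If `pq` crosses `rs`, then `r` and `s` lie strictly on opposite sides of the line `pq`, unless
both lie on that line. -/
lemma det_mul_det_neg_of_crosses {p q r s : ℝ × ℝ} (h : Crosses p q r s)
    (hne : det p q r ≠ 0 ∨ det p q s ≠ 0) : det p q r * det p q s < 0 := by
  obtain ⟨x, ⟨a, b, -, -, hab, rfl⟩, ⟨c, d, hc, hd, hcd, hx⟩, -⟩ := h
  have key : c * det p q r + d * det p q s = 0 := by
    have h1 := congrArg Prod.fst hx
    have h2 := congrArg Prod.snd hx
    simp only [Prod.fst_add, Prod.snd_add, Prod.smul_fst, Prod.smul_snd, smul_eq_mul] at h1 h2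
    obtain rfl : a = 1 - b := by linarith
    obtain rfl : c = 1 - d := by linarith
    simp only [det]
    linear_combination (p.2 - q.2) * h1 + (q.1 - p.1) * h2
  have hr : det p q r = -(d / c) * det p q s := by field_simp; linarith
  have hs : det p q s ≠ 0 := by
    intro h0
    rw [h0, mul_zero] at hr
    exact hne.elim (absurd hr) (absurd h0)
  rw [hr]
  have : 0 < d / c * (det p q s * det p q s) := mul_pos (div_pos hd hc) (mul_self_pos.2 hs)
  linarith

lemma crosses_symm {p q r s : ℝ × ℝ} (h : Crosses p q r s) : Crosses r s p q := by
  obtain ⟨x, h1, h2, h3⟩ := h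
  exact ⟨x, h2, h1, by rw [Set.inter_comm, h3]⟩

/-- Crossing segments do not have the same endpoints. -/
lemma not_endpoints_subset {p q r s : ℝ × ℝ} (h : Crosses p q r s) (hrs : r ≠ s) :
    ¬ ((r = p ∨ r = q) ∧ (s = p ∨ s = q)) := by
  obtain ⟨x, -, -, h3⟩ := h
  rintro ⟨hr, hs⟩
  have hr' : r ∈ segment ℝ p q ∩ segment ℝ r s :=
    ⟨by rcases hr with rfl | rfl <;> simp [left_mem_segment, right_mem_segment],
      left_mem_segment ℝ r s⟩
  have hs' : s ∈ segment ℝ p q ∩ segment ℝ r s :=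
    ⟨by rcases hs with rfl | rfl <;> simp [left_mem_segment, right_mem_segment],
      right_mem_segment ℝ r s⟩
  rw [h3] at hr' hs'
  exact hrs (hr'.trans hs'.symm)

lemma det_mul_det_neg {S : Finset (ℝ × ℝ)}
    (hS : ∀ p ∈ S, ∀ q ∈ S, ∀ r ∈ S, p ≠ q → p ≠ r → q ≠ r → det p q r ≠ 0)
    {p q r s : ℝ × ℝ} (hp : p ∈ S) (hq : q ∈ S) (hr : r ∈ S) (hs : s ∈ S) (hpq : p ≠ q)
    (hrs : r ≠ s) (h : Crosses p q r s) : det p q r * det p q s < 0 := by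
  refine det_mul_det_neg_of_crosses h ?_
  by_contra! h0
  refine not_endpoints_subset h hrs ⟨?_, ?_⟩
  · by_contra! hn
    exact hS p hp q hq r hr hpq hn.1.symm hn.2.symm h0.1
  · by_contra! hn
    exact hS p hp q hq s hs hpq hn.1.symm hn.2.symm h0.2

/-- The embedding of the grid `ℕ × ℕ` into the plane. -/
def toPlane (p : ℕ × ℕ) : ℝ × ℝ := (p.1, p.2)

lemma toPlane_injective : Function.Injective toPlane := by
  rintro ⟨a, b⟩ ⟨c, d⟩ h
  simpa [toPlane] using h

/-- The triangle `pqr` is oriented counterclockwise. -/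
def ccw (p q r : ℕ × ℕ) : Bool :=
  Nat.blt (((p.1.mul r.2).add (q.1.mul p.2)).add (r.1.mul q.2))
    (((p.1.mul q.2).add (q.1.mul r.2)).add (r.1.mul p.2))

lemma ccw_iff (p q r : ℕ × ℕ) :
    ccw p q r = true ↔ 0 < det (toPlane p) (toPlane q) (toPlane r) := by
  simp only [ccw, Nat.add_eq, Nat.mul_eq, Nat.blt_eq, det, toPlane, sub_pos]
  exact_mod_cast Iff.rfl

section Search

variable {α : Type*}

/-! The functions below are written with recursors, which the kernel evaluates faster than
compiled structural recursion. -/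

/-- `filterThen P k l acc` applies `k` to the elements of `l` satisfying `P`, added to `acc`.
The continuation forces the list to be evaluated before `k` is called. -/
def filterThen (P : α → Bool) (k : List α → Bool) (l : List α) : List α → Bool :=
  List.rec (motive := fun _ => List α → Bool) k
    (fun a _ ih acc => cond (P a) (ih (a :: acc)) (ih acc)) l

lemma exists_of_filterThen {P : α → Bool} {k : List α → Bool} {l acc : List α}
    (h : filterThen P k l acc = true) :
    ∃ m, k m = true ∧ (∀ a ∈ l, P a = true → a ∈ m) ∧ ∀ a ∈ acc, a ∈ m := by
  induction l generalizing acc with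
  | nil => exact ⟨acc, h, by simp, fun _ => id⟩
  | cons b l ih =>
    replace h : cond (P b) (filterThen P k l (b :: acc)) (filterThen P k l acc) = true := h
    cases hb : P b <;> simp only [hb, cond_true, cond_false] at h <;>
      obtain ⟨m, hk, hl, hacc⟩ := ih h
    · refine ⟨m, hk, ?_, hacc⟩
      simpa [hb] using hl
    · exact ⟨m, hk, by simpa using ⟨fun _ => hacc b (by simp), hl⟩,
        fun a ha => hacc a (by simp [ha])⟩

/-- `allTails f l` checks `f a r` for every tail `a :: r` of `l`. -/
def allTails (f : α → List α → Bool) (l : List α) : Bool :=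
  List.rec (motive := fun _ => Bool) true (fun a r ih => cond (f a r) ih false) l

lemma allTails_cons {f : α → List α → Bool} {a : α} {l : List α} :
    allTails f (a :: l) = true ↔ f a l = true ∧ allTails f l = true := by
  change cond (f a l) (allTails f l) false = true ↔ _
  cases f a l <;> simp

/-- `cliqueFree R k l` checks that `l` has no `k` elements pairwise related by `R`. -/
def cliqueFree (R : α → α → Bool) (k : ℕ) : List α → Bool :=
  Nat.rec (motive := fun _ => List α → Bool) (fun _ => false)
    (fun _ ih => allTails fun a r => filterThen (R a) ih r []) k

lemma cliqueFree_succ_cons {R : α → α → Bool} {k : ℕ} {a : α} {l : List α} :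
    cliqueFree R (k + 1) (a :: l) = true ↔
      filterThen (R a) (cliqueFree R k) l [] = true ∧ cliqueFree R (k + 1) l = true :=
  allTails_cons (f := fun a r => filterThen (R a) (cliqueFree R k) r [])

lemma not_clique_of_cliqueFree [DecidableEq α] {R : α → α → Bool} {k : ℕ} {l : List α}
    (h : cliqueFree R k l = true) {s : Finset α} (hs : ∀ a ∈ s, a ∈ l)
    (hR : ∀ a ∈ s, ∀ b ∈ s, a ≠ b → R a b = true) : s.card ≠ k := by
  induction k generalizing l s with
  | zero => simp [cliqueFree] at h
  | succ k ih =>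
    induction l with
    | nil =>
      obtain rfl : s = ∅ := Finset.eq_empty_of_forall_notMem fun a ha => by simpa using hs a ha
      simp
    | cons a l ihl =>
      rw [cliqueFree_succ_cons] at h
      by_cases ha : a ∈ s
      · obtain ⟨m, hm, hl, -⟩ := exists_of_filterThen h.1
        have := ih hm (s := s.erase a)
          (fun b hb => by
            obtain ⟨hne, hb⟩ := Finset.mem_erase.1 hb
            exact hl b ((List.mem_cons.1 (hs b hb)).resolve_left hne) (hR a ha b hb hne.symm))
          (fun b hb c hc => hR b (Finset.mem_of_mem_erase hb) c (Finset.mem_of_mem_erase hc))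
        rw [Finset.card_erase_of_mem ha] at this
        have := Finset.card_pos.2 ⟨a, ha⟩
        omega
      · exact ihl h.2 fun b hb =>
          (List.mem_cons.1 (hs b hb)).resolve_left (by rintro rfl; exact ha hb)

/-- The list of unordered pairs from `l`, each listed once. -/
def pairs : List α → List (α × α)
  | [] => []
  | a :: l => l.map (fun b => (a, b)) ++ pairs l

lemma mem_of_mem_pairs {l : List α} {x : α × α} (hx : x ∈ pairs l) : x.1 ∈ l ∧ x.2 ∈ l := by
  induction l with
  | nil => simp [pairs] at hx
  | cons a l ih =>
    simp only [pairs, List.mem_append, List.mem_map] at hx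
    rcases hx with ⟨b, hb, rfl⟩ | hx
    · simp [hb]
    · exact ⟨by simp [(ih hx).1], by simp [(ih hx).2]⟩

lemma mem_pairs_or {l : List α} {a b : α} (ha : a ∈ l) (hb : b ∈ l) (hab : a ≠ b) :
    (a, b) ∈ pairs l ∨ (b, a) ∈ pairs l := by
  induction l with
  | nil => simp at ha
  | cons c l ih =>
    simp only [pairs, List.mem_append, List.mem_map, Prod.mk.injEq]
    rcases List.mem_cons.1 ha with rfl | ha' <;> rcases List.mem_cons.1 hb with rfl | hb'
    · exact absurd rfl hab
    · exact .inl (.inl ⟨b, hb', rfl, rfl⟩)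
    · exact .inr (.inl ⟨a, ha', rfl, rfl⟩)
    · exact (ih ha' hb').imp .inr .inr

/-- The bit mask of the elements of `l` satisfying `P`. -/
def mask (P : α → Bool) (l : List α) : ℕ :=
  List.rec (motive := fun _ => ℕ) 0
    (fun a _ ih => cond (P a) (Nat.succ (Nat.mul 2 ih)) (Nat.mul 2 ih)) l

lemma mask_cons (P : α → Bool) (a : α) (l : List α) :
    mask P (a :: l) = Nat.bit (P a) (mask P l) := rfl

lemma mask_land_mask_ne_zero {P Q : α → Bool} {l : List α} {a : α} (ha : a ∈ l)
    (hP : P a = true) (hQ : Q a = true) : mask P l &&& mask Q l ≠ 0 := by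
  induction l with
  | nil => simp at ha
  | cons b l ih =>
    rw [mask_cons, mask_cons, Nat.land_bit, Ne, Nat.bit_eq_zero_iff, not_and_or]
    rcases List.mem_cons.1 ha with rfl | h
    · simp [hP, hQ]
    · exact .inl (ih h)

end Search

/-- The `25` points: the centre `(42, 42)` and eight orbits of the affine map of order three
`(42 + x, 42 + y) ↦ (42 - y, 42 + x - y)`. -/
def points : List (ℕ × ℕ) :=
  [(38, 40), (44, 40), (44, 46),
    (48, 37), (47, 53), (31, 36),
    (72, 30), (54, 84), (0, 12),
    (47, 46), (38, 43), (41, 37),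
    (5, 15), (69, 32), (52, 79),
    (49, 68), (16, 23), (61, 35),
    (71, 31), (53, 82), (2, 13),
    (48, 70), (14, 20), (64, 36),
    (42, 42)]

lemma points_genPos : ∀ p ∈ points, ∀ q ∈ points, ∀ r ∈ points, p ≠ q → p ≠ r → q ≠ r →
    det (toPlane p) (toPlane q) (toPlane r) ≠ 0 := by
  have h : (points.all fun p => points.all fun q => points.all fun r =>
      ccw p q r || ccw q p r || p == q || p == r || q == r) = true := by
    decide +kernel
  intro p hp q hq r hr hpq hpr hqr h0
  have h1 := List.all_eq_true.1 (List.all_eq_true.1 (List.all_eq_true.1 h p hp) q hq) r hr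
  have h2 : det (toPlane q) (toPlane p) (toPlane r) = 0 := by
    rw [← neg_eq_zero, ← h0]; simp only [det]; ring
  simp [hpq, hpr, hqr, ccw_iff, h0, h2] at h1

/-- The masks, relative to `points`, of the two endpoints of a segment, of the points on its left
and of the points on its right. -/
def code (e : (ℕ × ℕ) × (ℕ × ℕ)) : ℕ × ℕ × ℕ :=
  (mask (fun r => r == e.1 || r == e.2) points, mask (ccw e.1 e.2) points,
    mask (ccw e.2 e.1) points)

/-- The masks `m` and `n` have a common element. -/
def meets (m n : ℕ) : Bool := !(Nat.beq (Nat.land m n) 0)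

/-- The segments coded by `x` and `y` have endpoints on both sides of each other. -/
def interleave (x y : ℕ × ℕ × ℕ) : Bool :=
  meets x.2.1 y.1 && meets x.2.2 y.1 && meets y.2.1 x.1 && meets y.2.2 x.1

lemma meets_mask {P Q : ℕ × ℕ → Bool} {r : ℕ × ℕ} (hr : r ∈ points) (hP : P r = true)
    (hQ : Q r = true) : meets (mask P points) (mask Q points) = true := by
  rw [meets, Bool.not_eq_true', ← Bool.not_eq_true, Nat.beq_eq]
  exact mask_land_mask_ne_zero hr hP hQ

lemma meets_of_det_mul_det_neg {p q r s : ℕ × ℕ} (hr : r ∈ points) (hs : s ∈ points)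
    (h : det (toPlane p) (toPlane q) (toPlane r) * det (toPlane p) (toPlane q) (toPlane s) < 0) :
    (meets (mask (ccw p q) points) (mask (fun t => t == r || t == s) points) &&
      meets (mask (ccw q p) points) (mask (fun t => t == r || t == s) points)) = true := by
  have hswap (t : ℝ × ℝ) : det (toPlane q) (toPlane p) t = -det (toPlane p) (toPlane q) t := by
    simp only [det]; ring
  rw [Bool.and_eq_true]
  rcases mul_neg_iff.1 h with ⟨h1, h2⟩ | ⟨h1, h2⟩
  · exact ⟨meets_mask hr ((ccw_iff ..).2 h1) (by simp),
      meets_mask hs ((ccw_iff ..).2 (by rw [hswap]; linarith)) (by simp)⟩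
  · exact ⟨meets_mask hs ((ccw_iff ..).2 h2) (by simp),
      meets_mask hr ((ccw_iff ..).2 (by rw [hswap]; linarith)) (by simp)⟩

lemma codes_cliqueFree : cliqueFree interleave 6 ((pairs points).map code) = true := by
  decide +kernel

lemma interleave_self {x : (ℕ × ℕ) × (ℕ × ℕ)} (hx : x ∈ pairs points) :
    interleave (code x) (code x) = false := by
  have h : ((pairs points).all fun x => !interleave (code x) (code x)) = true := by
    decide +kernel
  simpa using List.all_eq_true.1 h x hx

/-- The image of `points` in the plane. -/
noncomputable def planePoints : Finset (ℝ × ℝ) := points.toFinset.image toPlane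

lemma mem_planePoints {p : ℝ × ℝ} : p ∈ planePoints ↔ ∃ a ∈ points, toPlane a = p := by
  simp [planePoints]

lemma planePoints_det_ne_zero : ∀ p ∈ planePoints, ∀ q ∈ planePoints, ∀ r ∈ planePoints,
    p ≠ q → p ≠ r → q ≠ r → det p q r ≠ 0 := by
  simp only [mem_planePoints]
  rintro _ ⟨a, ha, rfl⟩ _ ⟨b, hb, rfl⟩ _ ⟨c, hc, rfl⟩ hab hac hbc
  exact points_genPos a ha b hb c hc (ne_of_apply_ne _ hab) (ne_of_apply_ne _ hac)
    (ne_of_apply_ne _ hbc)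

/-- Every segment of `planePoints` is represented, up to reversal, in `pairs points`. -/
lemma exists_mem_pairs {e : (ℝ × ℝ) × (ℝ × ℝ)}
    (he : e.1 ∈ planePoints ∧ e.2 ∈ planePoints ∧ e.1 ≠ e.2) :
    ∃ x ∈ pairs points, (toPlane x.1, toPlane x.2) = e ∨ (toPlane x.2, toPlane x.1) = e := by
  obtain ⟨p, q⟩ := e
  obtain ⟨hp, hq, hpq⟩ := he
  obtain ⟨a, ha, rfl⟩ := mem_planePoints.1 hp
  obtain ⟨b, hb, rfl⟩ := mem_planePoints.1 hq
  rcases mem_pairs_or ha hb (ne_of_apply_ne toPlane hpq) with h | h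
  · exact ⟨_, h, .inl rfl⟩
  · exact ⟨_, h, .inr rfl⟩

lemma interleave_of_crosses {e f : (ℝ × ℝ) × (ℝ × ℝ)}
    (he : e.1 ∈ planePoints ∧ e.2 ∈ planePoints ∧ e.1 ≠ e.2)
    (hf : f.1 ∈ planePoints ∧ f.2 ∈ planePoints ∧ f.1 ≠ f.2)
    (h : Crosses e.1 e.2 f.1 f.2) {x y : (ℕ × ℕ) × (ℕ × ℕ)}
    (hxp : x ∈ pairs points) (hyp : y ∈ pairs points)
    (hx : (toPlane x.1, toPlane x.2) = e ∨ (toPlane x.2, toPlane x.1) = e)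
    (hy : (toPlane y.1, toPlane y.2) = f ∨ (toPlane y.2, toPlane y.1) = f) :
    interleave (code x) (code y) = true := by
  have h1 := det_mul_det_neg planePoints_det_ne_zero he.1 he.2.1 hf.1 hf.2.1 he.2.2 hf.2.2 h
  have h2 := det_mul_det_neg planePoints_det_ne_zero hf.1 hf.2.1 he.1 he.2.1 hf.2.2 he.2.2
    (crosses_symm h)
  have hrev (p q r s : ℝ × ℝ) : det q p r * det q p s = det p q r * det p q s := by
    simp only [det]; ring
  have hxy := hrev (toPlane x.1) (toPlane x.2) (toPlane y.1) (toPlane y.2)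
  have hyx := hrev (toPlane y.1) (toPlane y.2) (toPlane x.1) (toPlane x.2)
  obtain ⟨hx1, hx2⟩ := mem_of_mem_pairs hxp
  obtain ⟨hy1, hy2⟩ := mem_of_mem_pairs hyp
  rw [interleave, Bool.and_assoc, Bool.and_eq_true]
  refine ⟨meets_of_det_mul_det_neg hy1 hy2 ?_, meets_of_det_mul_det_neg hx1 hx2 ?_⟩
  all_goals
    rcases hx with rfl | rfl <;> rcases hy with rfl | rfl <;> dsimp only at h1 h2 <;> linarith

lemma planePoints_not_hasCrossingFamily : ¬ HasCrossingFamily planePoints 6 := by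
  rintro ⟨F, ⟨hF, hcross⟩, hcard⟩
  choose! g hg hge using fun e he => exists_mem_pairs (hF e he)
  have hcr : ∀ e ∈ F, ∀ f ∈ F, e ≠ f → interleave (code (g e)) (code (g f)) = true :=
    fun e he f hf hef => interleave_of_crosses (hF e he) (hF f hf) (hcross e he f hf hef)
      (hg e he) (hg f hf) (hge e he) (hge f hf)
  have hinj : Set.InjOn (code ∘ g) F := by
    intro e he f hf hgef
    by_contra hef
    have := hcr e he f hf hef
    rw [show code (g e) = code (g f) from hgef, interleave_self (hg f hf)] at this
    contradiction
  refine not_clique_of_cliqueFree codes_cliqueFree (s := F.image (code ∘ g)) ?_ ?_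
    ((Finset.card_image_of_injOn hinj).trans hcard)
  · exact Finset.forall_mem_image.2 fun e he => List.mem_map_of_mem (hg e he)
  · simp only [Finset.mem_image]
    rintro _ ⟨e, he, rfl⟩ _ ⟨f, hf, rfl⟩ hne
    exact hcr e he f hf (ne_of_apply_ne _ hne)

end CrossingFamily

open CrossingFamily

/-- There exists a set of 25 points in the plane in general position that
contains no 6-crossing family. -/
theorem exists_25_points_without_6_crossing_family :
    ∃ S : Finset (ℝ × ℝ), S.card = 25 ∧ GenPos S ∧ ¬ HasCrossingFamily S 6 := by
  refine ⟨planePoints, ?_, ?_, planePoints_not_hasCrossingFamily⟩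
  · rw [planePoints, Finset.card_image_of_injective _ toPlane_injective]
    decide +kernel
  · intro p hp q hq r hr hpq hpr hqr h
    exact planePoints_det_ne_zero p hp q hq r hr hpq hpr hqr (det_eq_zero_of_collinear h)
end

section
/- Let S be a set of n points in the plane in general position with cf(S) = k. Then for every integer N ≥ n there exists a set S' of N points in the plane in general position such that cf(S') ≤ k·⌈N/n⌉. -/
/-- Twice the signed area of the triangle `abc`. -/
def orient (a b c : ℝ × ℝ) : ℝ :=
  (b.1 - a.1) * (c.2 - a.2) - (b.2 - a.2) * (c.1 - a.1)

lemma collinear_iff_orient_eq_zero {a b c : ℝ × ℝ} (hab : a ≠ b) :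
    Collinear ℝ ({a, b, c} : Set (ℝ × ℝ)) ↔ orient a b c = 0 := by
  rw [collinear_iff_of_mem (p₀ := a) (by simp)]
  constructor
  · rintro ⟨v, hv⟩
    obtain ⟨r, hr⟩ := hv b (by simp)
    obtain ⟨s, hs⟩ := hv c (by simp)
    rw [hr, hs]
    simp [orient]
    ring
  · intro h
    refine ⟨b - a, ?_⟩
    have hc : ∃ s : ℝ, c = s • (b - a) +ᵥ a := by
      unfold orient at h
      by_cases h1 : b.1 - a.1 = 0
      · have h2 : b.2 - a.2 ≠ 0 := fun h2 =>
          hab (Prod.ext (by linarith) (by linarith))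
        have h3 : c.1 - a.1 = 0 := by
          rw [h1] at h
          simpa [h2] using h
        refine ⟨(c.2 - a.2) / (b.2 - a.2), Prod.ext ?_ ?_⟩
        · simp [h1]; linarith
        · simp; field_simp; ring
      · refine ⟨(c.1 - a.1) / (b.1 - a.1), Prod.ext ?_ ?_⟩
        · simp; field_simp; ring
        · simp; field_simp; linarith
    intro p hp
    rcases hp with rfl | rfl | rfl
    · exact ⟨0, by simp⟩
    · exact ⟨1, by simp⟩
    · exact hc

lemma genPos_iff_orient_ne_zero (S : Finset (ℝ × ℝ)) :
    GenPos S ↔ ∀ p ∈ S, ∀ q ∈ S, ∀ r ∈ S, p ≠ q → p ≠ r → q ≠ r →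
      orient p q r ≠ 0 := by
  refine forall₂_congr fun p _ => forall₂_congr fun q _ => forall₂_congr fun r _ =>
    forall_congr' fun hpq => forall_congr' fun _ => forall_congr' fun _ => ?_
  rw [collinear_iff_orient_eq_zero hpq]

lemma GenPos.mono {S T : Finset (ℝ × ℝ)} (hT : GenPos T) (h : S ⊆ T) : GenPos S :=
  fun p hp q hq r hr => hT p (h hp) q (h hq) r (h hr)

lemma Crosses.symm {a b c d : ℝ × ℝ} (h : Crosses a b c d) : Crosses c d a b := by
  obtain ⟨x, h1, h2, h3⟩ := h
  exact ⟨x, h2, h1, by rw [Set.inter_comm, h3]⟩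

lemma Crosses.swap_left {a b c d : ℝ × ℝ} (h : Crosses a b c d) : Crosses b a c d := by
  obtain ⟨x, h1, h2, h3⟩ := h
  exact ⟨x, by rwa [openSegment_symm], h2, by rwa [segment_symm]⟩

lemma Crosses.swap_right {a b c d : ℝ × ℝ} (h : Crosses a b c d) : Crosses a b d c :=
  h.symm.swap_left.symm

lemma orient_of_mem_openSegment {a b c d x : ℝ × ℝ} (h : x ∈ openSegment ℝ c d) :
    ∃ s t : ℝ, 0 < s ∧ 0 < t ∧ orient a b x = s * orient a b c + t * orient a b d := by
  obtain ⟨s, t, hs, ht, hst, rfl⟩ := h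
  refine ⟨s, t, hs, ht, ?_⟩
  obtain rfl : t = 1 - s := by linarith
  simp [orient]
  ring

lemma orient_self_left (a b : ℝ × ℝ) : orient a b a = 0 := by simp [orient]

lemma orient_self_right (a b : ℝ × ℝ) : orient a b b = 0 := by simp [orient]; ring

lemma Crosses.orient_mul_neg {a b c d : ℝ × ℝ} (h : Crosses a b c d)
    (hc : orient a b c ≠ 0) : orient a b c * orient a b d < 0 := by
  obtain ⟨x, hx, hx', -⟩ := h
  obtain ⟨s, t, -, -, h1⟩ := orient_of_mem_openSegment (a := a) (b := b) hx
  obtain ⟨s', t', hs, ht, h2⟩ := orient_of_mem_openSegment (a := a) (b := b) hx'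
  rw [orient_self_left, orient_self_right] at h1
  have h3 : t' * (orient a b c * orient a b d) = - (s' * (orient a b c) ^ 2) := by
    linear_combination orient a b c * (h1 - h2)
  have h4 : 0 < s' * (orient a b c) ^ 2 := by positivity
  by_contra! h5
  have := mul_nonneg ht.le h5
  linarith

/-- If `b` and `d` lie strictly on opposite sides of the line `ac`, then the segments
`ab` and `cd` do not cross. -/
lemma not_crosses_of_orient {a b c d : ℝ × ℝ}
    (h : orient a c b * orient a c d < 0) : ¬Crosses a b c d := by
  rintro ⟨x, hx, hx', -⟩
  obtain ⟨s, t, -, ht, h1⟩ := orient_of_mem_openSegment (a := a) (b := c) hx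
  obtain ⟨s', t', -, ht', h2⟩ := orient_of_mem_openSegment (a := a) (b := c) hx'
  rw [orient_self_left] at h1
  rw [orient_self_right] at h2
  have h3 : t * orient a c b = t' * orient a c d := by linarith
  have h4 : t * (orient a c b * orient a c d) = t' * (orient a c d) ^ 2 := by
    linear_combination orient a c d * h3
  have h5 : 0 ≤ t' * (orient a c d) ^ 2 := by positivity
  have := mul_neg_of_pos_of_neg ht h
  linarith

lemma mem_openSegment_div {a b x : ℝ × ℝ} {u v : ℝ} (huv : u * v < 0)
    (h : (u - v) • x = u • b - v • a) : x ∈ openSegment ℝ a b := by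
  have h0 : u - v ≠ 0 := by
    intro h0
    obtain rfl : u = v := by linarith
    nlinarith [mul_self_nonneg u]
  have hsq : 0 < (u - v) ^ 2 := by positivity
  refine ⟨-v / (u - v), u / (u - v), ?_, ?_, ?_, ?_⟩
  · rw [show -v / (u - v) = (v ^ 2 - u * v) / (u - v) ^ 2 by field_simp; ring]
    apply div_pos _ hsq
    nlinarith [sq_nonneg v]
  · rw [show u / (u - v) = (u ^ 2 - u * v) / (u - v) ^ 2 by field_simp]
    apply div_pos _ hsq
    nlinarith [sq_nonneg u]
  · field_simp; ring
  · have : x = (u - v)⁻¹ • (u • b - v • a) := by rw [← h, inv_smul_smul₀ h0]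
    rw [this]
    ext <;> simp <;> ring

lemma crosses_of_orient {a b c d : ℝ × ℝ}
    (h1 : orient a b c * orient a b d < 0) (h2 : orient c d a * orient c d b < 0) :
    Crosses a b c d := by
  have hD : orient c d a - orient c d b ≠ 0 := by
    intro h0
    rw [sub_eq_zero.1 h0] at h2
    nlinarith [mul_self_nonneg (orient c d b)]
  have hDD : orient c d a - orient c d b = -(orient a b c - orient a b d) := by
    simp only [orient]; ring
  set x : ℝ × ℝ := (orient c d a - orient c d b)⁻¹ • (orient c d a • b - orient c d b • a)
    with hx
  have hx1 : (orient c d a - orient c d b) • x = orient c d a • b - orient c d b • a := by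
    rw [hx, smul_inv_smul₀ hD]
  have hx2 : (orient a b c - orient a b d) • x = orient a b c • d - orient a b d • c := by
    have h3 : orient a b c • d - orient a b d • c
        = -(orient c d a • b - orient c d b • a) := by
      ext <;> simp [orient] <;> ring
    rw [h3, ← hx1, hDD, neg_smul, neg_neg]
  have hxm : x ∈ openSegment ℝ a b := mem_openSegment_div h2 hx1
  have hxm' : x ∈ openSegment ℝ c d := mem_openSegment_div h1 hx2
  refine ⟨x, hxm, hxm', Set.eq_singleton_iff_unique_mem.2
    ⟨⟨openSegment_subset_segment _ _ _ hxm, openSegment_subset_segment _ _ _ hxm'⟩, ?_⟩⟩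
  rintro y ⟨⟨s, t, -, -, hst, rfl⟩, ⟨s', t', -, -, hst', hy⟩⟩
  have h3 : s * orient c d a + t * orient c d b = 0 := by
    have e : orient c d (s • a + t • b) = s * orient c d a + t * orient c d b := by
      obtain rfl : t = 1 - s := by linarith
      simp [orient]; ring
    rw [← e, ← hy]
    obtain rfl : t' = 1 - s' := by linarith
    simp [orient]; ring
  have h4 : (orient c d a - orient c d b) • (s • a + t • b)
      = orient c d a • b - orient c d b • a := by
    obtain rfl : t = 1 - s := by linarith
    ext
    · simp; linear_combination (a.1 - b.1) * h3
    · simp; linear_combination (a.2 - b.2) * h3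
  rw [hx, ← h4, inv_smul_smul₀ hD]

lemma Crosses.left_ne_left {S : Finset (ℝ × ℝ)} (hS : GenPos S) {a b c d : ℝ × ℝ}
    (ha : a ∈ S) (hb : b ∈ S) (hd : d ∈ S) (hab : a ≠ b) (hcd : c ≠ d)
    (h : Crosses a b c d) : a ≠ c := by
  rintro rfl
  by_cases hbd : b = d
  · subst hbd
    obtain ⟨x, -, -, h⟩ := h
    rw [Set.inter_self] at h
    have h1 : a ∈ ({x} : Set (ℝ × ℝ)) := h ▸ left_mem_segment ℝ a b
    have h2 : b ∈ ({x} : Set (ℝ × ℝ)) := h ▸ right_mem_segment ℝ a b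
    exact hab (h1.trans h2.symm)
  · have h0 := (genPos_iff_orient_ne_zero S).1 hS a ha b hb d hd hab hcd hbd
    have := h.swap_right.orient_mul_neg h0
    rw [orient_self_left] at this
    simp at this

/-- In a bipartite multigraph with maximum degree at most `m`, some matching contains at least
a `1 / m` fraction of the edges. -/
lemma exists_matching_card_le {ι α β : Type*} [DecidableEq α] [DecidableEq β]
    (F : Finset ι) (a : ι → α) (b : ι → β) (m : ℕ)
    (ha : ∀ x, (F.filter fun i => a i = x).card ≤ m)
    (hb : ∀ y, (F.filter fun i => b i = y).card ≤ m) :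
    ∃ T ⊆ F, Set.InjOn a T ∧ Set.InjOn b T ∧ F.card ≤ m * T.card := by
  classical
  let A := F.image a
  let nb : Finset α → Finset β := fun X => (F.filter fun i => a i ∈ X).image b
  obtain ⟨X, hX, hmax⟩ := Finset.exists_max_image A.powerset
    (fun X => (X.card : ℤ) - (nb X).card) ⟨∅, by simp⟩
  rw [Finset.mem_powerset] at hX
  have hd0 : (nb X).card ≤ X.card := by
    have := hmax ∅ (by simp)
    simp [nb] at this ⊢
    exact this
  let d := X.card - (nb X).card
  let t : A → Finset (β ⊕ Fin d) := fun x => (nb {x.1}).disjSum Finset.univ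
  have hall : ∀ s : Finset A, s.card ≤ (s.biUnion t).card := by
    intro s
    rcases s.eq_empty_or_nonempty with rfl | ⟨x₀, hx₀⟩
    · simp
    have hsub : (nb (s.map (Function.Embedding.subtype _))).disjSum
        (Finset.univ : Finset (Fin d)) ⊆ s.biUnion t := by
      intro z hz
      rcases z with y | j
      · simp [nb] at hz
        obtain ⟨i, ⟨hi, h1, h2⟩, rfl⟩ := hz
        refine Finset.mem_biUnion.2 ⟨_, h2, ?_⟩
        simp [t, nb]
        exact ⟨i, ⟨hi, rfl⟩, rfl⟩
      · exact Finset.mem_biUnion.2 ⟨x₀, hx₀, by simp [t]⟩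
    have h1 := Finset.card_le_card hsub
    have h2 := hmax (s.map (Function.Embedding.subtype _)) (by
      rw [Finset.mem_powerset]
      intro z hz
      simp at hz
      exact hz.1)
    simp only [Finset.card_disjSum, Finset.card_univ, Fintype.card_fin,
      Finset.card_map] at h1 h2
    omega
  obtain ⟨f, hf, hft⟩ := (Finset.all_card_le_biUnion_card_iff_exists_injective t).1 hall
  let M : Finset A := Finset.univ.filter fun x => (f x).isLeft
  have hM : A.card ≤ M.card + d := by
    have h1 : (Finset.univ.filter fun x : A => ¬ (f x).isLeft).card ≤ d := by
      have : ((Finset.univ.filter fun x : A => ¬ (f x).isLeft).image f).card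
          ≤ (Finset.univ.map (Function.Embedding.inr : Fin d ↪ β ⊕ Fin d)).card := by
        apply Finset.card_le_card
        intro z hz
        obtain ⟨x, hx, rfl⟩ := Finset.mem_image.1 hz
        rcases h : f x with y | j
        · simp [h] at hx
        · simp
      rw [Finset.card_image_of_injective _ hf] at this
      simpa using this
    have h2 := Finset.card_filter_add_card_filter_not (s := (Finset.univ : Finset A))
      (fun x => ((f x).isLeft : Prop))
    rw [Finset.card_univ, Fintype.card_coe] at h2
    simp only [M]
    omega
  have hedge : ∀ x : A, ∃ i ∈ F, a i = x ∧ ((f x).isLeft → f x = Sum.inl (b i)) := by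
    intro x
    have hx := hft x
    rcases h : f x with y | j
    · rw [h] at hx
      simp [t, nb] at hx
      obtain ⟨i, ⟨hi, h1⟩, h2⟩ := hx
      exact ⟨i, hi, h1, fun _ => by rw [h2]⟩
    · obtain ⟨i, hi, h1⟩ := Finset.mem_image.1 x.2
      exact ⟨i, hi, h1, by simp⟩
  choose e heF hea heb using hedge
  have hinj : Function.Injective e := fun x y h => Subtype.ext (by rw [← hea, ← hea, h])
  refine ⟨M.image e, ?_, ?_, ?_, ?_⟩
  · intro i hi
    obtain ⟨x, -, rfl⟩ := Finset.mem_image.1 hi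
    exact heF x
  · intro i hi j hj h
    obtain ⟨x, -, rfl⟩ := Finset.mem_image.1 (Finset.mem_coe.1 hi)
    obtain ⟨y, -, rfl⟩ := Finset.mem_image.1 (Finset.mem_coe.1 hj)
    rw [hea, hea] at h
    rw [Subtype.ext h]
  · intro i hi j hj h
    obtain ⟨x, hx, rfl⟩ := Finset.mem_image.1 (Finset.mem_coe.1 hi)
    obtain ⟨y, hy, rfl⟩ := Finset.mem_image.1 (Finset.mem_coe.1 hj)
    simp only [M, Finset.mem_filter, Finset.mem_univ, true_and] at hx hy
    rw [hf (by rw [heb x hx, heb y hy, h] : f x = f y)]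
  · rw [Finset.card_image_of_injective _ hinj]
    have hcov : F ⊆ ((A \ X).biUnion fun x => F.filter fun i => a i = x) ∪
        ((nb X).biUnion fun y => F.filter fun i => b i = y) := by
      intro i hi
      by_cases h : a i ∈ X
      · refine Finset.mem_union_right _ (Finset.mem_biUnion.2 ⟨b i, ?_, by simp [hi]⟩)
        exact Finset.mem_image.2 ⟨i, by simp [hi, h], rfl⟩
      · refine Finset.mem_union_left _ (Finset.mem_biUnion.2 ⟨a i, ?_, by simp [hi]⟩)
        exact Finset.mem_sdiff.2 ⟨Finset.mem_image_of_mem a hi, h⟩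
    have h1 := (Finset.card_le_card hcov).trans (Finset.card_union_le _ _)
    have h2 := Finset.card_biUnion_le_card_mul (A \ X) _ m fun x _ => ha x
    have h3 := Finset.card_biUnion_le_card_mul (nb X) _ m fun y _ => hb y
    have h4 := Finset.card_sdiff_add_card_eq_card hX
    have h5 : (A \ X).card + (nb X).card ≤ M.card := by omega
    calc F.card ≤ m * ((A \ X).card + (nb X).card) := by linarith
      _ ≤ m * M.card := Nat.mul_le_mul_left m h5

lemma HasCrossingFamily.le_cf {S : Finset (ℝ × ℝ)} {k : ℕ} (h : HasCrossingFamily S k) :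
    k ≤ cf S := by
  refine le_csSup ⟨(S ×ˢ S).card, ?_⟩ h
  rintro _ ⟨F, hF, rfl⟩
  exact Finset.card_le_card fun e he =>
    Finset.mem_product.2 ⟨(hF.1 e he).1, (hF.1 e he).2.1⟩

lemma one_le_cf {S : Finset (ℝ × ℝ)} (hS : 2 ≤ S.card) : 1 ≤ cf S := by
  obtain ⟨p, hp, q, hq, hpq⟩ := Finset.one_lt_card.1 hS
  refine HasCrossingFamily.le_cf ⟨{(p, q)}, ⟨?_, ?_⟩, by simp⟩
  · simp [hp, hq, hpq]
  · intro e he f hf hef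
    rw [Finset.mem_singleton] at he hf
    exact absurd (he.trans hf.symm) hef

lemma cf_le {S : Finset (ℝ × ℝ)} {b : ℕ}
    (h : ∀ F, IsCrossingFamily S F → F.card ≤ b) : cf S ≤ b := by
  refine csSup_le ⟨0, ∅, by simp [IsCrossingFamily], rfl⟩ ?_
  rintro _ ⟨F, hF, rfl⟩
  exact h F hF

lemma IsCrossingFamily.mono {S T : Finset (ℝ × ℝ)} {F : Finset ((ℝ × ℝ) × (ℝ × ℝ))}
    (hF : IsCrossingFamily S F) (h : S ⊆ T) : IsCrossingFamily T F :=
  ⟨fun e he => ⟨h (hF.1 e he).1, h (hF.1 e he).2.1, (hF.1 e he).2.2⟩, hF.2⟩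

/-- The `i`-th point of the cluster that replaces `p`: these points lie on a small parabola
through `p` whose tangent at `p` has slope `c`. -/
def clusterPoint (c t : ℝ) (p : ℝ × ℝ) (i : ℕ) : ℝ × ℝ :=
  (p.1 + t * i, p.2 + c * (t * i) + (t * i) ^ 2)

/-- The height of a point above the line of slope `c` through the origin. -/
def height (c : ℝ) (p : ℝ × ℝ) : ℝ := p.2 - c * p.1

lemma exists_injOn_height (S : Finset (ℝ × ℝ)) : ∃ c, Set.InjOn (height c) S := by
  obtain ⟨c, hc⟩ := Infinite.exists_notMem_finset
    ((S ×ˢ S).image fun e => (e.1.2 - e.2.2) / (e.1.1 - e.2.1))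
  refine ⟨c, fun p hp q hq h => ?_⟩
  unfold height at h
  by_cases h1 : p.1 = q.1
  · exact Prod.ext h1 (by rw [h1] at h; linarith)
  · refine absurd (Finset.mem_image.2 ⟨(p, q), Finset.mem_product.2 ⟨hp, hq⟩, ?_⟩) hc
    have := sub_ne_zero.2 h1
    field_simp
    linarith

open Filter Topology in
lemma eventually_orient_clusterPoint {p q r : ℝ × ℝ} (c : ℝ) (h : orient p q r ≠ 0)
    (i j l : ℕ) : ∀ᶠ t in 𝓝[>] (0 : ℝ), 0 < orient p q r *
      orient (clusterPoint c t p i) (clusterPoint c t q j) (clusterPoint c t r l) := by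
  have hc : Continuous fun t => orient p q r *
      orient (clusterPoint c t p i) (clusterPoint c t q j) (clusterPoint c t r l) := by
    unfold orient clusterPoint
    fun_prop
  refine (hc.continuousAt.eventually_mem (IsOpen.mem_nhds isOpen_Ioi ?_)).filter_mono
    nhdsWithin_le_nhds
  simpa [clusterPoint] using mul_self_pos.2 h

open Filter Topology in
lemma eventually_orient_clusterPoint_pair {c : ℝ} {p q : ℝ × ℝ}
    (h : height c p ≠ height c q) {i j : ℕ} (hij : i ≠ j) (l : ℕ) :
    ∀ᶠ t in 𝓝[>] (0 : ℝ), 0 < ((j - i : ℝ) * (height c q - height c p)) *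
      orient (clusterPoint c t p i) (clusterPoint c t p j) (clusterPoint c t q l) := by
  let G : ℝ → ℝ := fun t =>
    ((j - i : ℝ) * (height c q - height c p)) * ((j - i : ℝ) *
      ((clusterPoint c t q l).2 - (clusterPoint c t p i).2 -
        (c + t * (i + j)) * ((clusterPoint c t q l).1 - (clusterPoint c t p i).1)))
  have hG : Continuous G := by
    unfold G clusterPoint
    fun_prop
  have h0 : 0 < G 0 := by
    have h1 : (j - i : ℝ) * (height c q - height c p) ≠ 0 :=
      mul_ne_zero (sub_ne_zero.2 (by exact_mod_cast hij.symm)) (sub_ne_zero.2 h.symm)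
    have h2 : G 0 = ((j - i : ℝ) * (height c q - height c p)) ^ 2 := by
      simp [G, clusterPoint, height]; ring
    rw [h2]; positivity
  have hev : ∀ᶠ t in 𝓝[>] (0 : ℝ), 0 < G t :=
    (hG.continuousAt.eventually_mem (IsOpen.mem_nhds isOpen_Ioi h0)).filter_mono
      nhdsWithin_le_nhds
  filter_upwards [hev, self_mem_nhdsWithin] with t ht ht0
  have : ((j - i : ℝ) * (height c q - height c p)) *
      orient (clusterPoint c t p i) (clusterPoint c t p j) (clusterPoint c t q l)
      = t * G t := by
    simp only [G, orient, clusterPoint]; ring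
  rw [this]
  exact mul_pos ht0 ht

open Filter Topology in
lemma eventually_clusterPoint_ne {p q : ℝ × ℝ} (c : ℝ) (h : p ≠ q) (i j : ℕ) :
    ∀ᶠ t in 𝓝[>] (0 : ℝ), clusterPoint c t p i ≠ clusterPoint c t q j := by
  have hc : Continuous fun t => (clusterPoint c t p i, clusterPoint c t q j) := by
    unfold clusterPoint
    fun_prop
  refine (hc.continuousAt.eventually_mem (IsOpen.mem_nhds
    isClosed_diagonal.isOpen_compl ?_)).filter_mono nhdsWithin_le_nhds
  simpa [clusterPoint] using h

/-- The parameter `t` is small enough for the clusters to imitate the points of `S`. -/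
structure IsSmall (S : Finset (ℝ × ℝ)) (c : ℝ) (m : ℕ) (t : ℝ) : Prop where
  pos : 0 < t
  ne : ∀ p ∈ S, ∀ q ∈ S, ∀ i < m, ∀ j < m, p ≠ q →
    clusterPoint c t p i ≠ clusterPoint c t q j
  pair : ∀ p ∈ S, ∀ q ∈ S, ∀ i < m, ∀ j < m, ∀ l < m, p ≠ q → i ≠ j →
    0 < ((j - i : ℝ) * (height c q - height c p)) *
      orient (clusterPoint c t p i) (clusterPoint c t p j) (clusterPoint c t q l)
  triple : ∀ p ∈ S, ∀ q ∈ S, ∀ r ∈ S, ∀ i < m, ∀ j < m, ∀ l < m, p ≠ q → p ≠ r → q ≠ r →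
    0 < orient p q r *
      orient (clusterPoint c t p i) (clusterPoint c t q j) (clusterPoint c t r l)

open Filter Topology in
lemma exists_isSmall {S : Finset (ℝ × ℝ)} (hS : GenPos S) {c : ℝ}
    (hc : Set.InjOn (height c) S) (m : ℕ) : ∃ t, IsSmall S c m t := by
  rw [genPos_iff_orient_ne_zero] at hS
  have h1 : ∀ᶠ t in 𝓝[>] (0 : ℝ), ∀ p ∈ S, ∀ q ∈ S, ∀ i ∈ Finset.range m,
      ∀ j ∈ Finset.range m, p ≠ q → clusterPoint c t p i ≠ clusterPoint c t q j := by
    simp only [eventually_all_finset, eventually_imp_distrib_left]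
    exact fun p _ q _ i _ j _ hpq => eventually_clusterPoint_ne c hpq i j
  have h2 : ∀ᶠ t in 𝓝[>] (0 : ℝ), ∀ p ∈ S, ∀ q ∈ S, ∀ i ∈ Finset.range m,
      ∀ j ∈ Finset.range m, ∀ l ∈ Finset.range m, p ≠ q → i ≠ j →
      0 < ((j - i : ℝ) * (height c q - height c p)) *
        orient (clusterPoint c t p i) (clusterPoint c t p j) (clusterPoint c t q l) := by
    simp only [eventually_all_finset, eventually_imp_distrib_left]
    exact fun p hp q hq i _ j _ l _ hpq hij =>
      eventually_orient_clusterPoint_pair (fun h => hpq (hc hp hq h)) hij l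
  have h3 : ∀ᶠ t in 𝓝[>] (0 : ℝ), ∀ p ∈ S, ∀ q ∈ S, ∀ r ∈ S, ∀ i ∈ Finset.range m,
      ∀ j ∈ Finset.range m, ∀ l ∈ Finset.range m, p ≠ q → p ≠ r → q ≠ r →
      0 < orient p q r *
        orient (clusterPoint c t p i) (clusterPoint c t q j) (clusterPoint c t r l) := by
    simp only [eventually_all_finset, eventually_imp_distrib_left]
    exact fun p hp q hq r hr i _ j _ l _ hpq hpr hqr =>
      eventually_orient_clusterPoint c (hS p hp q hq r hr hpq hpr hqr) i j l
  obtain ⟨t, h1, h2, h3, h0⟩ := (h1.and (h2.and (h3.and self_mem_nhdsWithin))).exists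
  simp only [Finset.mem_range] at h1 h2 h3
  exact ⟨t, h0, h1, h2, h3⟩

/-- The set obtained from `S` by replacing every point by a cluster of `m` points. -/
noncomputable def blowUp (S : Finset (ℝ × ℝ)) (c : ℝ) (m : ℕ) (t : ℝ) : Finset (ℝ × ℝ) :=
  (S ×ˢ Finset.range m).image fun e => clusterPoint c t e.1 e.2

lemma mem_blowUp {S : Finset (ℝ × ℝ)} {c : ℝ} {m : ℕ} {t : ℝ} {x : ℝ × ℝ} :
    x ∈ blowUp S c m t ↔ ∃ p ∈ S, ∃ i < m, clusterPoint c t p i = x := by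
  simp [blowUp, and_assoc]

namespace IsSmall

variable {S : Finset (ℝ × ℝ)} {c : ℝ} {m : ℕ} {t : ℝ}

lemma index_inj (h : IsSmall S c m t) {p : ℝ × ℝ} {i j : ℕ}
    (he : clusterPoint c t p i = clusterPoint c t p j) : i = j := by
  have h1 := congrArg Prod.fst he
  simpa [clusterPoint, h.pos.ne'] using h1

lemma card_blowUp (h : IsSmall S c m t) : (blowUp S c m t).card = S.card * m := by
  rw [blowUp, Finset.card_image_of_injOn, Finset.card_product, Finset.card_range]
  rintro ⟨p, i⟩ hp ⟨q, j⟩ hq he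
  simp only [Finset.coe_product, Set.mem_prod, Finset.mem_coe, Finset.mem_range] at hp hq
  by_cases hpq : p = q
  · subst hpq
    exact Prod.ext rfl (h.index_inj he)
  · exact absurd he (h.ne p hp.1 q hq.1 i hp.2 j hq.2 hpq)

lemma genPos_blowUp (h : IsSmall S c m t) : GenPos (blowUp S c m t) := by
  rw [genPos_iff_orient_ne_zero]
  intro x hx y hy z hz hxy hxz hyz
  obtain ⟨p, hp, i, hi, rfl⟩ := mem_blowUp.1 hx
  obtain ⟨q, hq, j, hj, rfl⟩ := mem_blowUp.1 hy
  obtain ⟨r, hr, l, hl, rfl⟩ := mem_blowUp.1 hz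
  have rot : ∀ a b c, orient a b c = orient b c a := by
    intro a b c; simp only [orient]; ring
  have idx : ∀ {p i j}, clusterPoint c t p i ≠ clusterPoint c t p j → i ≠ j :=
    fun h e => h (by rw [e])
  by_cases hpq : p = q
  · subst hpq
    by_cases hpr : p = r
    · subst hpr
      have h1 : orient (clusterPoint c t p i) (clusterPoint c t p j) (clusterPoint c t p l)
          = t ^ 3 * (((j : ℝ) - i) * ((l : ℝ) - i) * ((l : ℝ) - j)) := by
        simp only [orient, clusterPoint]; ring
      have e1 : (j : ℝ) - i ≠ 0 := sub_ne_zero.2 (by exact_mod_cast (idx hxy).symm)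
      have e2 : (l : ℝ) - i ≠ 0 := sub_ne_zero.2 (by exact_mod_cast (idx hxz).symm)
      have e3 : (l : ℝ) - j ≠ 0 := sub_ne_zero.2 (by exact_mod_cast (idx hyz).symm)
      rw [h1]
      exact mul_ne_zero (pow_ne_zero _ h.pos.ne') (mul_ne_zero (mul_ne_zero e1 e2) e3)
    · exact right_ne_zero_of_mul (h.pair p hp r hr i hi j hj l hl hpr (idx hxy)).ne'
  · by_cases hpr : p = r
    · subst hpr
      rw [rot, rot]
      exact right_ne_zero_of_mul (h.pair p hp q hq l hl i hi j hj hpq (idx hxz.symm)).ne'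
    · by_cases hqr : q = r
      · subst hqr
        rw [rot]
        exact right_ne_zero_of_mul
          (h.pair q hq p hp j hj l hl i hi (Ne.symm hpq) (idx hyz)).ne'
      · exact right_ne_zero_of_mul (ne_of_gt
          (h.triple p hp q hq r hr i hi j hj l hl hpq hpr hqr))

/-- A segment with both endpoints in the cluster of `p` only crosses segments with an endpoint
in that cluster. -/
lemma eq_or_eq_of_crosses (h : IsSmall S c m t) {p r s : ℝ × ℝ} {i j l l' : ℕ}
    (hp : p ∈ S) (hr : r ∈ S) (hs : s ∈ S) (hi : i < m) (hj : j < m) (hl : l < m)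
    (hl' : l' < m) (hij : i ≠ j)
    (hx : Crosses (clusterPoint c t p i) (clusterPoint c t p j)
      (clusterPoint c t r l) (clusterPoint c t s l')) : r = p ∨ s = p := by
  by_contra! hne
  obtain ⟨hrp, hsp⟩ := hne
  by_cases hrs : r = s
  · subst hrs
    have h1 := h.pair p hp r hr i hi j hj l hl hrp.symm hij
    have h2 := h.pair p hp r hr i hi j hj l' hl' hrp.symm hij
    have h3 := hx.orient_mul_neg (right_ne_zero_of_mul h1.ne')
    nlinarith [mul_pos h1 h2, sq_nonneg ((j - i : ℝ) * (height c r - height c p))]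
  · have h1 := h.triple r hr s hs p hp l hl l' hl' i hi hrs hrp hsp
    have h2 := h.triple r hr s hs p hp l hl l' hl' j hj hrs hrp hsp
    have h3 := hx.symm.orient_mul_neg (right_ne_zero_of_mul h1.ne')
    nlinarith [mul_pos h1 h2, sq_nonneg (orient r s p)]

/-- Crossing segments that go from the cluster of `p` upwards and downwards, respectively, do
not exist. -/
lemma not_crosses_of_height (h : IsSmall S c m t) {p q r : ℝ × ℝ} {i j l l' : ℕ}
    (hp : p ∈ S) (hq : q ∈ S) (hr : r ∈ S) (hi : i < m) (hj : j < m) (hl : l < m)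
    (hl' : l' < m) (hil : i ≠ l') (hpq : height c p < height c q)
    (hrp : height c r < height c p) :
    ¬Crosses (clusterPoint c t p i) (clusterPoint c t q j)
      (clusterPoint c t r l) (clusterPoint c t p l') := by
  intro hx
  refine not_crosses_of_orient ?_ hx.swap_right
  have h1 := h.pair p hp q hq i hi l' hl' j hj (by rintro rfl; exact hpq.false) hil
  have h2 := h.pair p hp r hr i hi l' hl' l hl (by rintro rfl; exact hrp.false) hil
  have h3 := mul_pos h1 h2
  have h4 : (height c q - height c p) * (height c r - height c p) < 0 :=
    mul_neg_of_pos_of_neg (by linarith) (by linarith)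
  by_contra! h5
  have h6 := mul_nonneg (sq_nonneg (l' - i : ℝ)) h5
  have h7 := mul_nonneg_of_nonpos_of_nonpos h4.le (neg_nonpos.2 h6)
  nlinarith

/-- Segments between four distinct clusters cross only if the segments between the underlying
points do. -/
lemma crosses_of_crosses (h : IsSmall S c m t) {p q r s : ℝ × ℝ} {i j l l' : ℕ}
    (hp : p ∈ S) (hq : q ∈ S) (hr : r ∈ S) (hs : s ∈ S) (hi : i < m) (hj : j < m) (hl : l < m)
    (hl' : l' < m) (hpq : p ≠ q) (hpr : p ≠ r) (hps : p ≠ s) (hqr : q ≠ r) (hqs : q ≠ s)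
    (hrs : r ≠ s)
    (hx : Crosses (clusterPoint c t p i) (clusterPoint c t q j)
      (clusterPoint c t r l) (clusterPoint c t s l')) : Crosses p q r s := by
  have key : ∀ {a b x y : ℝ}, 0 < a * x → 0 < b * y → x * y < 0 → a * b < 0 := by
    intro a b x y h1 h2 h3
    by_contra! h4
    nlinarith [mul_pos h1 h2, mul_nonneg h4 (neg_nonneg.2 h3.le)]
  have h1 := h.triple p hp q hq r hr i hi j hj l hl hpq hpr hqr
  have h2 := h.triple p hp q hq s hs i hi j hj l' hl' hpq hps hqs
  have h3 := h.triple r hr s hs p hp l hl l' hl' i hi hrs hpr.symm hps.symm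
  have h4 := h.triple r hr s hs q hq l hl l' hl' j hj hrs hqr.symm hqs.symm
  exact crosses_of_orient
    (key h1 h2 (hx.orient_mul_neg (right_ne_zero_of_mul h1.ne')))
    (key h3 h4 (hx.symm.orient_mul_neg (right_ne_zero_of_mul h3.ne')))

lemma card_le (h : IsSmall S c m t) (hc : Set.InjOn (height c) S) (hS : 2 ≤ S.card)
    {F : Finset ((ℝ × ℝ) × (ℝ × ℝ))} (hF : IsCrossingFamily (blowUp S c m t) F) :
    F.card ≤ cf S * m := by
  classical
  have hrep : ∀ e : F, ∃ p ∈ S, ∃ q ∈ S, ∃ i < m, ∃ j < m, height c p ≤ height c q ∧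
      clusterPoint c t p i ≠ clusterPoint c t q j ∧
      (e.1 = (clusterPoint c t p i, clusterPoint c t q j) ∨
        e.1 = (clusterPoint c t q j, clusterPoint c t p i)) := by
    rintro ⟨⟨x, y⟩, he⟩
    obtain ⟨hx, hy, hxy⟩ := hF.1 _ he
    obtain ⟨p, hp, i, hi, rfl⟩ := mem_blowUp.1 hx
    obtain ⟨q, hq, j, hj, rfl⟩ := mem_blowUp.1 hy
    rcases le_total (height c p) (height c q) with hle | hle
    · exact ⟨p, hp, q, hq, i, hi, j, hj, hle, hxy, Or.inl rfl⟩
    · exact ⟨q, hq, p, hp, j, hj, i, hi, hle, hxy.symm, Or.inr rfl⟩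
  choose lo hlo hi hhi il hil ih hih hle hne heq using hrep
  have hcross : ∀ e f : F, e ≠ f → Crosses (clusterPoint c t (lo e) (il e))
      (clusterPoint c t (hi e) (ih e)) (clusterPoint c t (lo f) (il f))
      (clusterPoint c t (hi f) (ih f)) := by
    intro e f hef
    have h0 := hF.2 e.1 e.2 f.1 f.2 (fun h => hef (Subtype.ext h))
    rcases heq e with h1 | h1 <;> rcases heq f with h2 | h2 <;> rw [h1, h2] at h0
    · exact h0
    · exact h0.swap_right
    · exact h0.swap_left
    · exact h0.swap_left.swap_right
  have hml : ∀ e, clusterPoint c t (lo e) (il e) ∈ blowUp S c m t :=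
    fun e => mem_blowUp.2 ⟨_, hlo e, _, hil e, rfl⟩
  have hmh : ∀ e, clusterPoint c t (hi e) (ih e) ∈ blowUp S c m t :=
    fun e => mem_blowUp.2 ⟨_, hhi e, _, hih e, rfl⟩
  have hg := h.genPos_blowUp
  have hll : ∀ e f, lo e = lo f → il e = il f → e = f := by
    intro e f h1 h2
    by_contra hef
    exact (hcross e f hef).left_ne_left hg (hml e) (hmh e) (hmh f) (hne e) (hne f)
      (by rw [h1, h2])
  have hhh : ∀ e f, hi e = hi f → ih e = ih f → e = f := by
    intro e f h1 h2
    by_contra hef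
    exact (hcross e f hef).swap_left.swap_right.left_ne_left hg (hmh e) (hml e) (hml f)
      (hne e).symm (hne f).symm (by rw [h1, h2])
  have hlh : ∀ e f, lo e = hi f → il e = ih f → e = f := by
    intro e f h1 h2
    by_contra hef
    exact (hcross e f hef).swap_right.left_ne_left hg (hml e) (hmh e) (hml f)
      (hne e) (hne f).symm (by rw [h1, h2])
  have hcardF : F.card = (Finset.univ : Finset F).card := by simp
  rw [hcardF]
  by_cases hloop : ∃ e, lo e = hi e
  · obtain ⟨e, he⟩ := hloop
    have htouch : ∀ f, lo f = lo e ∨ hi f = lo e := by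
      intro f
      by_cases hef : e = f
      · exact Or.inl (by rw [hef])
      have hx := hcross e f hef
      have hne' := hne e
      rw [← he] at hx hne'
      exact h.eq_or_eq_of_crosses (hlo e) (hlo f) (hhi f) (hil e) (hih e) (hil f) (hih f)
        (fun h' => hne' (by rw [h'])) hx
    have hcard : (Finset.univ : Finset F).card ≤ (Finset.range m).card := by
      refine Finset.card_le_card_of_injOn (fun f => if lo f = lo e then il f else ih f) ?_ ?_
      · intro f _
        simp only [Finset.coe_range, Set.mem_Iio]
        split_ifs
        · exact hil f
        · exact hih f
      · intro f _ g _ hfg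
        simp only at hfg
        split_ifs at hfg with h1 h2 h2
        · exact hll f g (h1.trans h2.symm) hfg
        · exact hlh f g (h1.trans ((htouch g).resolve_left h2).symm) hfg
        · exact (hlh g f (h2.trans ((htouch f).resolve_left h1).symm) hfg.symm).symm
        · exact hhh f g (((htouch f).resolve_left h1).trans
            ((htouch g).resolve_left h2).symm) hfg
    rw [Finset.card_range] at hcard
    exact hcard.trans (Nat.le_mul_of_pos_left m (one_le_cf hS))
  · push Not at hloop
    have hlt : ∀ e, height c (lo e) < height c (hi e) := fun e =>
      lt_of_le_of_ne (hle e) fun h' => hloop e (hc (hlo e) (hhi e) h')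
    have hsep : ∀ e f, lo e ≠ hi f := by
      intro e f hef
      by_cases h1 : e = f
      · exact hloop e (by rw [hef, h1])
      have h2 := hlt f
      rw [← hef] at h2
      have hx := hcross e f h1
      rw [← hef] at hx
      exact h.not_crosses_of_height (hlo e) (hhi e) (hlo f) (hil e) (hih e) (hil f) (hih f)
        (fun h3 => h1 (hlh e f hef h3)) (hlt e) h2 hx
    obtain ⟨T, -, hTa, hTb, hT⟩ := exists_matching_card_le (Finset.univ : Finset F) lo hi m
      (fun x => by
        rw [← Finset.card_range m]
        refine Finset.card_le_card_of_injOn il (fun f _ => by simpa using hil f) ?_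
        intro f hf g hg hfg
        simp at hf hg
        exact hll f g (hf.trans hg.symm) hfg)
      (fun x => by
        rw [← Finset.card_range m]
        refine Finset.card_le_card_of_injOn ih (fun f _ => by simpa using hih f) ?_
        intro f hf g hg hfg
        simp at hf hg
        exact hhh f g (hf.trans hg.symm) hfg)
    have hTS : HasCrossingFamily S T.card := by
      refine ⟨T.image fun f => (lo f, hi f), ⟨?_, ?_⟩, Finset.card_image_of_injOn ?_⟩
      · intro e he
        obtain ⟨f, -, rfl⟩ := Finset.mem_image.1 he
        exact ⟨hlo f, hhi f, hloop f⟩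
      · intro e he e' he' hee
        obtain ⟨f, hf, rfl⟩ := Finset.mem_image.1 he
        obtain ⟨g, hg, rfl⟩ := Finset.mem_image.1 he'
        have hfg : f ≠ g := by rintro rfl; exact hee rfl
        exact h.crosses_of_crosses (hlo f) (hhi f) (hlo g) (hhi g) (hil f) (hih f) (hil g)
          (hih g) (hloop f) (fun h' => hfg (hTa hf hg h')) (hsep f g) (hsep g f).symm
          (fun h' => hfg (hTb hf hg h')) (hloop g) (hcross f g hfg)
      · intro f hf g hg hfg
        exact hTa hf hg (congrArg Prod.fst hfg)
    calc _ ≤ m * T.card := hT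
      _ ≤ m * cf S := Nat.mul_le_mul_left m hTS.le_cf
      _ = cf S * m := mul_comm _ _

end IsSmall

/-- Let `S` be a set of `n` points in general position with `cf S = k`. Then
for every `N ≥ n` there exists a set `S'` of `N` points in general position
with `cf S' ≤ k * ⌈N / n⌉`. -/
theorem exists_superset_cardinality_with_cf_le
    (S : Finset (ℝ × ℝ)) (hgp : GenPos S) (hS : 2 ≤ S.card)
    (k : ℕ) (hk : cf S = k) (N : ℕ) (hN : S.card ≤ N) :
    ∃ S' : Finset (ℝ × ℝ), S'.card = N ∧ GenPos S' ∧
      cf S' ≤ k * (N ⌈/⌉ S.card) := by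
  obtain ⟨c, hc⟩ := exists_injOn_height S
  obtain ⟨t, ht⟩ := exists_isSmall hgp hc (N ⌈/⌉ S.card)
  have hcard : N ≤ (blowUp S c (N ⌈/⌉ S.card) t).card := by
    rw [ht.card_blowUp]
    simpa using le_smul_ceilDiv (b := N) (by omega : 0 < S.card)
  obtain ⟨S', hS', hS'N⟩ := Finset.exists_subset_card_eq hcard
  subst hk
  exact ⟨S', hS'N, ht.genPos_blowUp.mono hS', cf_le fun F hF => ht.card_le hc hS (hF.mono hS')⟩
end
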